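/- Let φ be a circle covering map of degree two of class C² with positive derivative, not topologically conjugate to the doubling map, such that the collection of all maximal periodic intervals of φ is finite and nonempty, say I₁,…,I_r, and set Λ := 𝕊¹ \ ⋃_{n≥0} φ^{-n}(I₁ ∪ ⋯ ∪ I_r). Then the set of parabolic periodic points of φ contained in Λ is finite. -/

import Mathlib

open Set Filter MeasureTheory Topology

noncomputable section

/-- `F : ℝ → ℝ` is a lift of `φ : 𝕊¹ → 𝕊¹` witnessing that `φ` is a
circle covering map of degree two. -/
def IsLiftDeg2 (φ : UnitAddCircle → UnitAddCircle) (F : ℝ → ℝ) : Prop :=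
  Continuous F ∧ StrictMono F ∧ (∀ x : ℝ, F (x + 1) = F x + 2) ∧
    ∀ x : ℝ, φ (x : UnitAddCircle) = ((F x : ℝ) : UnitAddCircle)

/-- The closed arc on the circle starting at `a` (counterclockwise) of length `ℓ`. -/
def closedArc (a ℓ : ℝ) : Set UnitAddCircle :=
  (fun t : ℝ => (t : UnitAddCircle)) '' Set.Icc a (a + ℓ)

/-- The open arc on the circle starting at `a` (counterclockwise) of length `ℓ`. -/
def openArc (a ℓ : ℝ) : Set UnitAddCircle :=
  (fun t : ℝ => (t : UnitAddCircle)) '' Set.Ioo a (a + ℓ)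

/-- The open arc `(x, x + ε)` counterclockwise. -/
def rightArc (x : UnitAddCircle) (ε : ℝ) : Set UnitAddCircle :=
  {y | ∃ t : ℝ, 0 < t ∧ t < ε ∧ y = x + (t : UnitAddCircle)}

/-- The open arc `(x - ε, x)` counterclockwise. -/
def leftArc (x : UnitAddCircle) (ε : ℝ) : Set UnitAddCircle :=
  {y | ∃ t : ℝ, 0 < t ∧ t < ε ∧ y = x - (t : UnitAddCircle)}

/-- `I` is a periodic interval of `φ` of period `s`: a proper nondegenerate closed arc
mapped onto itself homeomorphically by `φ^s`. -/
def IsPeriodicInterval (φ : UnitAddCircle → UnitAddCircle) (s : ℕ)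
    (I : Set UnitAddCircle) : Prop :=
  1 ≤ s ∧ (∃ a ℓ : ℝ, 0 < ℓ ∧ ℓ < 1 ∧ I = closedArc a ℓ) ∧ Set.BijOn (φ^[s]) I I

/-- A maximal periodic interval of `φ`. -/
def IsMaxPeriodicInterval (φ : UnitAddCircle → UnitAddCircle)
    (I : Set UnitAddCircle) : Prop :=
  (∃ s, IsPeriodicInterval φ s I) ∧ ∀ J, (∃ s, IsPeriodicInterval φ s J) → I ⊆ J → I = J

/-- `Λ = 𝕊¹ \ ⋃ₙ φ⁻ⁿ(I₁ ∪ ⋯ ∪ I_r)`, the complement of all preimages of the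
maximal periodic intervals. -/
def lambdaSet (φ : UnitAddCircle → UnitAddCircle) : Set UnitAddCircle :=
  Set.univ \ ⋃ n : ℕ, (φ^[n]) ⁻¹' (⋃ I ∈ {I | IsMaxPeriodicInterval φ I}, I)

/-- The doubling map `x ↦ 2x (mod 1)`. -/
def doubling : UnitAddCircle → UnitAddCircle := fun x => x + x

/-- `φ` is topologically conjugate to the doubling map. -/
def ConjugateToDoubling (φ : UnitAddCircle → UnitAddCircle) : Prop :=
  ∃ h : UnitAddCircle ≃ₜ UnitAddCircle, ∀ x, h (φ x) = doubling (h x)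

/-- `I` is a `φ`-dyadic interval of degree `n` (described via the lift `F` of `φ`):
a closed arc whose endpoints are consecutive `φⁿ`-preimages of `0`. -/
def IsDyadic (F : ℝ → ℝ) (n : ℕ) (I : Set UnitAddCircle) : Prop :=
  ∃ a b : ℝ, a < b ∧ (∃ k : ℤ, F^[n] a = (k : ℝ)) ∧ F^[n] b = F^[n] a + 1 ∧
    I = (fun t : ℝ => (t : UnitAddCircle)) '' Set.Icc a b

/-- `G` is a lift of the orientation-preserving circle homeomorphism `g`. -/
def IsOPLift (g : UnitAddCircle → UnitAddCircle) (G : ℝ → ℝ) : Prop :=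
  Continuous G ∧ StrictMono G ∧ (∀ x : ℝ, G (x + 1) = G x + 1) ∧
    ∀ x : ℝ, g (x : UnitAddCircle) = ((G x : ℝ) : UnitAddCircle)

/-- `g` belongs to the Ghys–Sergiescu Thompson group `T_φ` (with `F` a lift of `φ`):
`g` is an orientation-preserving circle homeomorphism and there are partitions of the
circle into `φ`-dyadic intervals `I k`, `J k` such that `g` maps `I k` onto `J k` and
`g = φ_{J k}⁻¹ ∘ φ_{I k}` on `I k`, i.e. `φ^[m k] ∘ g = φ^[n k]` on `I k`. -/
def InThompsonGroup (φ : UnitAddCircle → UnitAddCircle) (F : ℝ → ℝ)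
    (g : UnitAddCircle → UnitAddCircle) : Prop :=
  (∃ G : ℝ → ℝ, IsOPLift g G) ∧
  ∃ (r : ℕ) (I J : Fin r → Set UnitAddCircle) (n m : Fin r → ℕ),
    0 < r ∧
    (∀ k, IsDyadic F (n k) (I k)) ∧ (∀ k, IsDyadic F (m k) (J k)) ∧
    (⋃ k, I k) = Set.univ ∧ (⋃ k, J k) = Set.univ ∧
    (Pairwise fun k l => interior (I k) ∩ interior (I l) = ∅) ∧
    (Pairwise fun k l => interior (J k) ∩ interior (J l) = ∅) ∧
    (∀ k, g '' I k = J k) ∧ (∀ k, ∀ x ∈ I k, φ^[m k] (g x) = φ^[n k] x)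

/-- `x` is a nonexpandable point for the action of `T_φ`: `g′(x) ≤ 1` for every
`g ∈ T_φ` (derivatives are computed via lifts). -/
def NonExpandable (φ : UnitAddCircle → UnitAddCircle) (F : ℝ → ℝ)
    (x : UnitAddCircle) : Prop :=
  ∀ g G, InThompsonGroup φ F g → IsOPLift g G →
    ∀ x' : ℝ, (x' : UnitAddCircle) = x → deriv G x' ≤ 1

/-- `I` is nice for `φ`: no forward iterate of the boundary returns to the interior. -/
def IsNice (φ : UnitAddCircle → UnitAddCircle) (I : Set UnitAddCircle) : Prop :=
  ∀ n : ℕ, 1 ≤ n → (φ^[n]) '' (frontier I) ∩ interior I = ∅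

/-- A nice interval: a proper nondegenerate closed arc that is nice. -/
def IsNiceInterval (φ : UnitAddCircle → UnitAddCircle) (I : Set UnitAddCircle) : Prop :=
  (∃ a ℓ : ℝ, 0 < ℓ ∧ ℓ < 1 ∧ I = closedArc a ℓ) ∧ IsNice φ I

/-- `J` is a connected component of `S`. -/
def IsComponentOf (J S : Set UnitAddCircle) : Prop :=
  ∃ x ∈ S, J = connectedComponentIn S x

/-- The set of left endpoints of connected components of `𝕊¹ \ Λ`. -/
def leftEndpoints (Λ : Set UnitAddCircle) : Set UnitAddCircle :=
  {z | ∃ C : Set UnitAddCircle, IsComponentOf C (Set.univ \ Λ) ∧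
    ∃ a ℓ : ℝ, 0 < ℓ ∧ ℓ ≤ 1 ∧ C = openArc a ℓ ∧ z = (a : UnitAddCircle)}

/-- The set of right endpoints of connected components of `𝕊¹ \ Λ`. -/
def rightEndpoints (Λ : Set UnitAddCircle) : Set UnitAddCircle :=
  {z | ∃ C : Set UnitAddCircle, IsComponentOf C (Set.univ \ Λ) ∧
    ∃ a ℓ : ℝ, 0 < ℓ ∧ ℓ ≤ 1 ∧ C = openArc a ℓ ∧ z = ((a + ℓ : ℝ) : UnitAddCircle)}

/-- `x` is a parabolic periodic point of `φ`: `φ^s(x) = x` and `(φ^s)′(x) = 1`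
(the derivative computed via the lift `F`). -/
def IsParabolicPeriodicPt (φ : UnitAddCircle → UnitAddCircle) (F : ℝ → ℝ)
    (x : UnitAddCircle) : Prop :=
  ∃ s : ℕ, 1 ≤ s ∧ φ^[s] x = x ∧
    ∀ x' : ℝ, (x' : UnitAddCircle) = x → deriv (F^[s]) x' = 1

section Lift

variable {φ : UnitAddCircle → UnitAddCircle} {F h : ℝ → ℝ}

lemma unitAddCircle_coe_eq_iff {x y : ℝ} :
    (x : UnitAddCircle) = (y : UnitAddCircle) ↔ ∃ m : ℤ, x = y + m := by
  rw [← sub_eq_zero, ← AddCircle.coe_sub, AddCircle.coe_eq_zero_iff]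
  constructor
  · rintro ⟨n, hn⟩
    exact ⟨n, by simp at hn; linarith⟩
  · rintro ⟨n, hn⟩
    exact ⟨n, by simp; linarith⟩

lemma IsLiftDeg2.map_add_intCast (hF : IsLiftDeg2 φ F) (x : ℝ) (m : ℤ) :
    F (x + m) = F x + 2 * m := by
  have hnat : ∀ (n : ℕ) (x : ℝ), F (x + n) = F x + 2 * n := by
    intro n
    induction n with
    | zero => simp
    | succ n ih =>
      intro x
      have := hF.2.2.1 (x + n)
      push_cast
      rw [← add_assoc, this, ih]
      ring
  obtain ⟨n, rfl | rfl⟩ := m.eq_nat_or_neg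
  · simpa using hnat n x
  · have := hnat n (x + ((-(n : ℤ) : ℤ) : ℝ))
    push_cast at this ⊢
    rw [neg_add_cancel_right] at this
    linarith

lemma IsLiftDeg2.iterate_add_intCast (hF : IsLiftDeg2 φ F) (n : ℕ) (x : ℝ) (m : ℤ) :
    F^[n] (x + m) = F^[n] x + ((2 ^ n * m : ℤ) : ℝ) := by
  induction n generalizing x m with
  | zero => simp
  | succ n ih =>
    rw [Function.iterate_succ_apply, Function.iterate_succ_apply, hF.map_add_intCast]
    have := ih (F x) (2 * m)
    push_cast at this ⊢
    rw [this]
    ring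

lemma IsLiftDeg2.iterate_coe (hF : IsLiftDeg2 φ F) (n : ℕ) (x : ℝ) :
    φ^[n] (x : UnitAddCircle) = ((F^[n] x : ℝ) : UnitAddCircle) := by
  induction n generalizing x with
  | zero => rfl
  | succ n ih => rw [Function.iterate_succ_apply, hF.2.2.2, ih, Function.iterate_succ_apply]

lemma IsLiftDeg2.surjective (hF : IsLiftDeg2 φ F) : Function.Surjective F := by
  intro y
  have h1 : F (0 + (⌊(y - F 0) / 2⌋ : ℤ)) ≤ y := by
    rw [hF.map_add_intCast]
    linarith [Int.floor_le ((y - F 0) / 2)]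
  have h2 : y ≤ F (0 + (⌈(y - F 0) / 2⌉ : ℤ)) := by
    rw [hF.map_add_intCast]
    linarith [Int.le_ceil ((y - F 0) / 2)]
  exact mem_range_of_exists_le_of_exists_ge hF.1 ⟨_, h1⟩ ⟨_, h2⟩

/-- `h` is a monotone continuous degree one map semiconjugating `F` to multiplication by two. -/
structure IsDoublingSemiconj (F h : ℝ → ℝ) : Prop where
  continuous : Continuous h
  monotone : Monotone h
  map_add_one : ∀ x, h (x + 1) = h x + 1
  map_map : ∀ x, h (F x) = 2 * h x

lemma IsLiftDeg2.bounded_sub_two_mul (hF : IsLiftDeg2 φ F) :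
    ∃ B, ∀ x, |F x - 2 * x| ≤ B := by
  have hper : Function.Periodic (fun x => F x - 2 * x) 1 := fun x => by
    simp only [hF.2.2.1]; ring
  have hc : Continuous (fun x => F x - 2 * x) := by
    have := hF.1
    fun_prop
  obtain ⟨B, hB⟩ := (hper.compact_of_continuous one_ne_zero hc).isBounded.exists_norm_le
  exact ⟨B, fun x => hB _ ⟨x, rfl⟩⟩

lemma IsLiftDeg2.exists_isDoublingSemiconj (hF : IsLiftDeg2 φ F) :
    ∃ h, IsDoublingSemiconj F h := by
  obtain ⟨B, hB⟩ := hF.bounded_sub_two_mul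
  set ψ : ℝ → ℝ := fun x => F x - 2 * x with hψ
  have hψc : Continuous ψ := by
    have := hF.1
    fun_prop
  have hbound : ∀ (n : ℕ) (x : ℝ), ‖ψ (F^[n] x) * (1 / 2) ^ (n + 1)‖ ≤ B * (1 / 2) ^ (n + 1) := by
    intro n x
    rw [norm_mul, Real.norm_eq_abs, Real.norm_of_nonneg (by positivity)]
    exact mul_le_mul_of_nonneg_right (hB _) (by positivity)
  have hgeom : HasSum (fun n : ℕ => B * (1 / 2 : ℝ) ^ (n + 1)) B := by
    have := hasSum_geometric_two.mul_left (B / 2)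
    rw [div_mul_cancel₀ B two_ne_zero] at this
    have heq : (fun n : ℕ => B * (1 / 2 : ℝ) ^ (n + 1)) = fun n => B / 2 * (1 / 2) ^ n := by
      ext n; ring
    rwa [heq]
  have hsum : ∀ x, Summable fun n : ℕ => ψ (F^[n] x) * (1 / 2 : ℝ) ^ (n + 1) := fun x =>
    Summable.of_norm_bounded hgeom.summable fun n => hbound n x
  set h : ℝ → ℝ := fun x => x + ∑' n : ℕ, ψ (F^[n] x) * (1 / 2 : ℝ) ^ (n + 1) with hh
  have hcont : Continuous h := by
    refine continuous_id.add (continuous_tsum (fun n => ?_) hgeom.summable hbound)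
    exact (hψc.comp (hF.1.iterate n)).mul continuous_const
  have hmap : ∀ x, h (F x) = 2 * h x := by
    intro x
    have h1 := (hsum x).tsum_eq_zero_add
    have h2 : ∑' n : ℕ, ψ (F^[n] (F x)) * (1 / 2 : ℝ) ^ (n + 1)
        = 2 * ∑' n : ℕ, ψ (F^[n + 1] x) * (1 / 2 : ℝ) ^ (n + 1 + 1) := by
      rw [← tsum_mul_left]
      refine tsum_congr fun n => ?_
      rw [Function.iterate_succ_apply]
      ring
    simp only [hh]
    rw [h2, h1]
    simp only [Function.iterate_zero, id, hψ]
    ring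
  have hiter : ∀ (n : ℕ) x, h (F^[n] x) = 2 ^ n * h x := by
    intro n
    induction n with
    | zero => simp
    | succ n ih => intro x; rw [Function.iterate_succ_apply, ih, hmap]; ring
  have hnear : ∀ x, |h x - x| ≤ B := by
    intro x
    simp only [hh, add_sub_cancel_left]
    exact tsum_of_norm_bounded hgeom fun n => hbound n x
  refine ⟨h, hcont, ?_, ?_, hmap⟩
  · intro x y hxy
    by_contra! hlt
    obtain ⟨n, hn⟩ := pow_unbounded_of_one_lt (2 * B / (h x - h y)) (one_lt_two)
    rw [div_lt_iff₀ (by linarith)] at hn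
    have h1 := hF.2.1.monotone.iterate n hxy
    have h2 := abs_le.1 (hnear (F^[n] x))
    have h3 := abs_le.1 (hnear (F^[n] y))
    rw [hiter] at h2 h3
    linarith
  · intro x
    simp only [hh]
    have : ∀ n, ψ (F^[n] (x + 1)) = ψ (F^[n] x) := by
      intro n
      have h1 := hF.iterate_add_intCast n x 1
      rw [Int.cast_one] at h1
      rw [h1]
      simp only [hψ, hF.map_add_intCast]
      ring
    simp only [this]
    ring

namespace IsDoublingSemiconj

lemma map_iterate (hh : IsDoublingSemiconj F h) (n : ℕ) (x : ℝ) :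
    h (F^[n] x) = 2 ^ n * h x := by
  induction n generalizing x with
  | zero => simp
  | succ n ih => rw [Function.iterate_succ_apply, ih, hh.map_map]; ring

lemma map_add_intCast (hh : IsDoublingSemiconj F h) (x : ℝ) (m : ℤ) :
    h (x + m) = h x + m := by
  have hnat : ∀ (n : ℕ) (x : ℝ), h (x + n) = h x + n := by
    intro n
    induction n with
    | zero => simp
    | succ n ih =>
      intro x
      have := hh.map_add_one (x + n)
      push_cast
      rw [← add_assoc, this, ih]
      ring
  obtain ⟨n, rfl | rfl⟩ := m.eq_nat_or_neg
  · simpa using hnat n x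
  · have := hnat n (x + ((-(n : ℤ) : ℤ) : ℝ))
    push_cast at this ⊢
    rw [neg_add_cancel_right] at this
    linarith

lemma lt_add_one_of_map_eq (hh : IsDoublingSemiconj F h) {x y : ℝ} (hxy : h x = h y) :
    y < x + 1 := by
  by_contra! hle
  have := hh.monotone hle
  rw [hh.map_add_one] at this
  linarith

/-- A periodic interval lifts into a fibre of the semiconjugacy. -/
lemma map_eq_of_isPeriodicInterval (hh : IsDoublingSemiconj F h) (hF : IsLiftDeg2 φ F)
    {s : ℕ} {a ℓ : ℝ} (hℓ : 0 < ℓ) (hℓ1 : ℓ < 1) (hs : 1 ≤ s)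
    (hbij : Set.BijOn (φ^[s]) (closedArc a ℓ) (closedArc a ℓ)) : h a = h (a + ℓ) := by
  have hle : h a ≤ h (a + ℓ) := hh.monotone (by linarith)
  have hlen : ∀ n : ℕ, F^[s * n] (a + ℓ) ≤ F^[s * n] a + 1 := by
    intro n
    by_contra! hlt
    have hmono := hF.2.1.iterate (s * n)
    obtain ⟨t, ht, hte⟩ := intermediate_value_Icc (by linarith : a ≤ a + ℓ)
      (hF.1.iterate (s * n)).continuousOn
      (show F^[s * n] a + 1 ∈ Icc (F^[s * n] a) (F^[s * n] (a + ℓ)) from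
        ⟨by linarith, hlt.le⟩)
    have hinj := (hbij.iterate n).injOn
    rw [← Function.iterate_mul] at hinj
    have heq : (t : UnitAddCircle) = (a : UnitAddCircle) := by
      refine hinj ⟨t, ht, rfl⟩ ⟨a, ⟨le_rfl, by linarith⟩, rfl⟩ ?_
      rw [hF.iterate_coe, hF.iterate_coe, hte, unitAddCircle_coe_eq_iff]
      exact ⟨1, by simp⟩
    obtain ⟨m, hm⟩ := unitAddCircle_coe_eq_iff.1 heq
    have hat : a < t := by
      rw [← hmono.lt_iff_lt, hte]
      linarith
    have h1 : (0 : ℝ) < m := by linarith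
    have h2 : (m : ℝ) < 1 := by linarith [ht.2]
    norm_cast at h1 h2
    omega
  by_contra hne
  have hlt : 0 < h (a + ℓ) - h a := by
    have := lt_of_le_of_ne hle hne
    linarith
  obtain ⟨n, hn⟩ := pow_unbounded_of_one_lt (1 / (h (a + ℓ) - h a)) (one_lt_two)
  rw [div_lt_iff₀ hlt] at hn
  have h1 := hh.monotone (hlen n)
  rw [hh.map_add_one, hh.map_iterate, hh.map_iterate] at h1
  have h2 : (2 : ℝ) ^ n ≤ 2 ^ (s * n) :=
    pow_le_pow_right₀ one_le_two (Nat.le_mul_of_pos_left n hs)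
  nlinarith

/-- The lift of a periodic point of `Λ` is alone in its fibre of the semiconjugacy. -/
lemma eq_of_map_eq_of_mem_lambdaSet (hh : IsDoublingSemiconj F h) (hF : IsLiftDeg2 φ F)
    {s : ℕ} (hs : 1 ≤ s) {q t : ℝ} (hq : (q : UnitAddCircle) ∈ lambdaSet φ)
    (hper : φ^[s] (q : UnitAddCircle) = q) (ht : h t = h q) : t = q := by
  by_contra hne
  set Z : Set ℝ := h ⁻¹' {h q} with hZ
  have hZc : IsCompact Z := by
    refine (isCompact_Icc (a := q - 1) (b := q + 1)).of_isClosed_subset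
      (isClosed_singleton.preimage hh.continuous) fun y hy => ?_
    have h1 := hh.lt_add_one_of_map_eq (show h y = h q from hy)
    have h2 := hh.lt_add_one_of_map_eq (show h q = h y from hy.symm)
    exact ⟨by linarith, h2.le⟩
  have hqZ : q ∈ Z := rfl
  obtain ⟨z₁, hz₁, hl⟩ := hZc.exists_isLeast ⟨q, hqZ⟩
  obtain ⟨z₂, hz₂, hg⟩ := hZc.exists_isGreatest ⟨q, hqZ⟩
  have hz₁' : h z₁ = h q := hz₁
  have hz₂' : h z₂ = h q := hz₂
  have hlt : z₁ < z₂ := by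
    rcases lt_or_gt_of_ne hne with hlt | hlt
    · exact (hl (show t ∈ Z from ht)).trans_lt (hlt.trans_le (hg hqZ))
    · exact (hl hqZ).trans_lt (hlt.trans_le (hg (show t ∈ Z from ht)))
  have hlen : z₂ < z₁ + 1 := hh.lt_add_one_of_map_eq (hz₁'.trans hz₂'.symm)
  have hmem : ∀ y, y ∈ Icc z₁ (z₁ + (z₂ - z₁)) ↔ h y = h q := by
    intro y
    rw [add_sub_cancel]
    refine ⟨fun hy => le_antisymm ?_ ?_, fun hy => ⟨hl hy, hg hy⟩⟩
    · exact hz₂' ▸ hh.monotone hy.2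
    · exact hz₁' ▸ hh.monotone hy.1
  obtain ⟨k, hk⟩ := unitAddCircle_coe_eq_iff.1 ((hF.iterate_coe s q).symm.trans hper)
  have hhk : 2 ^ s * h q = h q + k := by
    rw [← hh.map_iterate, hk, hh.map_add_intCast]
  have hbij : Set.BijOn (φ^[s]) (closedArc z₁ (z₂ - z₁)) (closedArc z₁ (z₂ - z₁)) := by
    refine ⟨?_, ?_, ?_⟩
    · rintro _ ⟨y, hy, rfl⟩
      refine ⟨F^[s] y - k, ?_, ?_⟩
      · rw [hmem] at hy ⊢
        have := hh.map_add_intCast (F^[s] y - k) k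
        rw [sub_add_cancel, hh.map_iterate, hy] at this
        linarith
      · simp only [hF.iterate_coe]
        rw [unitAddCircle_coe_eq_iff]
        exact ⟨-k, by push_cast; ring⟩
    · rintro _ ⟨y, hy, rfl⟩ _ ⟨y', hy', rfl⟩ hyy
      rw [hmem] at hy hy'
      simp only [hF.iterate_coe] at hyy
      obtain ⟨m, hm⟩ := unitAddCircle_coe_eq_iff.1 hyy
      have hm0 : (m : ℝ) = 0 := by
        have := congrArg h hm
        rw [hh.map_add_intCast, hh.map_iterate, hh.map_iterate, hy, hy'] at this
        linarith
      rw [hm0, add_zero] at hm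
      simp only [(hF.2.1.iterate s).injective hm]
    · rintro _ ⟨y, hy, rfl⟩
      obtain ⟨u, hu⟩ := hF.surjective.iterate s (y + k)
      refine ⟨u, ⟨u, ?_, rfl⟩, ?_⟩
      · rw [hmem] at hy ⊢
        have := congrArg h hu
        rw [hh.map_iterate, hh.map_add_intCast, hy, ← hhk] at this
        exact mul_left_cancel₀ (by positivity) this
      · simp only [hF.iterate_coe]
        rw [hu, unitAddCircle_coe_eq_iff]
        exact ⟨k, rfl⟩
  have hmax : IsMaxPeriodicInterval φ (closedArc z₁ (z₂ - z₁)) := by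
    refine ⟨⟨s, hs, ⟨z₁, z₂ - z₁, by linarith, by linarith, rfl⟩, hbij⟩, ?_⟩
    rintro J ⟨s', hs', ⟨b, ℓ', hℓ, hℓ1, rfl⟩, hJ⟩ hsub
    refine hsub.antisymm ?_
    have hb := hh.map_eq_of_isPeriodicInterval hF hℓ hℓ1 hs' hJ
    have hconst : ∀ t ∈ Icc b (b + ℓ'), h t = h b := fun t ht =>
      le_antisymm (hb ▸ hh.monotone ht.2) (hh.monotone ht.1)
    obtain ⟨t₀, ht₀, hte⟩ := hsub ⟨z₁, (hmem z₁).2 hz₁', rfl⟩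
    obtain ⟨m, hm⟩ := unitAddCircle_coe_eq_iff.1 hte
    rintro _ ⟨t', ht', rfl⟩
    refine ⟨t' - m, (hmem _).2 ?_, ?_⟩
    · have h1 := hh.map_add_intCast (t' - m) m
      have h2 := hh.map_add_intCast z₁ m
      rw [sub_add_cancel, hconst t' ht'] at h1
      rw [← hm, hconst t₀ ht₀] at h2
      linarith
    · simp only [unitAddCircle_coe_eq_iff]
      exact ⟨-m, by push_cast; ring⟩
  refine hq.2 (mem_iUnion.2 ⟨0, ?_⟩)
  exact mem_biUnion (show closedArc z₁ (z₂ - z₁) ∈ {I | IsMaxPeriodicInterval φ I} from hmax)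
    ⟨q, (hmem q).2 rfl, rfl⟩

/-- Only finitely many points of `Λ` have a given period. -/
lemma finite_lambdaSet_isPeriodicPt (hh : IsDoublingSemiconj F h) (hF : IsLiftDeg2 φ F)
    {s : ℕ} (hs : 1 ≤ s) : {x | x ∈ lambdaSet φ ∧ φ^[s] x = x}.Finite := by
  have hsub : {x | x ∈ lambdaSet φ ∧ φ^[s] x = x} ⊆ (fun t : ℝ => (t : UnitAddCircle)) ''
      {t : ℝ | t ∈ Icc (0 : ℝ) 1 ∧ (t : UnitAddCircle) ∈ lambdaSet φ ∧
        φ^[s] (t : UnitAddCircle) = t} := by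
    rintro x ⟨hx, hxs⟩
    obtain ⟨t, ht, rfl⟩ : ∃ t ∈ Ico (0 : ℝ) (0 + 1), (t : UnitAddCircle) = x := by
      have := AddCircle.coe_image_Ico_eq (1 : ℝ) 0
      have hx' : x ∈ (univ : Set UnitAddCircle) := trivial
      rwa [← this] at hx'
    exact ⟨t, ⟨⟨ht.1, by linarith [ht.2]⟩, hx, hxs⟩, rfl⟩
  refine Set.Finite.subset (Set.Finite.image _ ?_) hsub
  refine Set.Finite.of_finite_image (f := h) ?_ ?_
  · have hpow : (1 : ℝ) ≤ 2 ^ s - 1 := by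
      have := pow_le_pow_right₀ (one_le_two (α := ℝ)) hs
      linarith
    refine ((Set.finite_Icc ⌊(2 ^ s - 1) * h 0⌋ ⌈(2 ^ s - 1) * h 1⌉).image
      (fun k : ℤ => (k : ℝ) / (2 ^ s - 1))).subset ?_
    rintro _ ⟨t, ⟨ht, -, hts⟩, rfl⟩
    obtain ⟨k, hk⟩ := unitAddCircle_coe_eq_iff.1 ((hF.iterate_coe s t).symm.trans hts)
    have hhk : (2 ^ s - 1) * h t = k := by
      have : 2 ^ s * h t = h t + k := by rw [← hh.map_iterate, hk, hh.map_add_intCast]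
      linarith
    refine ⟨k, ⟨?_, ?_⟩, ?_⟩
    · have h1 := Int.floor_le ((2 ^ s - 1) * h 0)
      have h2 := mul_le_mul_of_nonneg_left (hh.monotone ht.1) (by linarith : (0 : ℝ) ≤ 2 ^ s - 1)
      have : ((⌊(2 ^ s - 1) * h 0⌋ : ℤ) : ℝ) ≤ k := by linarith
      exact_mod_cast this
    · have h1 := Int.le_ceil ((2 ^ s - 1) * h 1)
      have h2 := mul_le_mul_of_nonneg_left (hh.monotone ht.2) (by linarith : (0 : ℝ) ≤ 2 ^ s - 1)
      have : (k : ℝ) ≤ (⌈(2 ^ s - 1) * h 1⌉ : ℤ) := by linarith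
      exact_mod_cast this
    · simp only
      rw [← hhk, mul_div_cancel_left₀ _ (by linarith)]
  · rintro t ⟨-, -, -⟩ t' ⟨-, ht', hts'⟩ heq
    exact hh.eq_of_map_eq_of_mem_lambdaSet hF hs ht' hts' heq

end IsDoublingSemiconj

lemma IsLiftDeg2.deriv_periodic (hF : IsLiftDeg2 φ F) : Function.Periodic (deriv F) 1 := by
  intro x
  rw [← deriv_comp_add_const]
  have : (fun x => F (x + 1)) = fun x => F x + 2 := funext hF.2.2.1
  rw [this, deriv_add_const]

lemma IsLiftDeg2.log_deriv_periodic (hF : IsLiftDeg2 φ F) :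
    Function.Periodic (fun t => Real.log (deriv F t)) 1 := fun x => by
  simp only [hF.deriv_periodic x]

lemma IsLiftDeg2.exists_lipschitz_log_deriv (hF : IsLiftDeg2 φ F) (hC2 : ContDiff ℝ 2 F)
    (hpos : ∀ x, 0 < deriv F x) :
    ∃ C, 0 ≤ C ∧ ∀ x y, |Real.log (deriv F x) - Real.log (deriv F y)| ≤ C * |x - y| := by
  have hd : ContDiff ℝ 1 (deriv F) := by
    have : ContDiff ℝ (1 + 1) F := by
      convert hC2 using 1
      norm_num
    exact (contDiff_succ_iff_deriv.1 this).2.2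
  have hg : ContDiff ℝ 1 (fun t => Real.log (deriv F t)) := hd.log fun x => (hpos x).ne'
  have hper : Function.Periodic (deriv fun t => Real.log (deriv F t)) 1 := by
    intro x
    rw [← deriv_comp_add_const]
    simp only [hF.deriv_periodic _]
  obtain ⟨C, hC⟩ := (hper.compact_of_continuous one_ne_zero
    (hg.continuous_deriv le_rfl)).isBounded.exists_norm_le
  refine ⟨C, (norm_nonneg _).trans (hC _ ⟨0, rfl⟩), fun x y => ?_⟩
  exact convex_univ.norm_image_sub_le_of_norm_deriv_le
    (fun z _ => (hg.differentiable one_ne_zero) z) (fun z _ => hC _ ⟨z, rfl⟩)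
    (mem_univ y) (mem_univ x)

lemma hasDerivAt_iterate_exp_birkhoffSum (hd : Differentiable ℝ F) (hpos : ∀ x, 0 < deriv F x)
    (n : ℕ) (x : ℝ) : HasDerivAt (F^[n])
      (Real.exp (birkhoffSum F (fun t => Real.log (deriv F t)) n x)) x := by
  induction n with
  | zero => simpa using hasDerivAt_id x
  | succ n ih =>
    rw [Function.iterate_succ', birkhoffSum_succ, Real.exp_add, Real.exp_log (hpos _), mul_comm]
    exact (hd _).hasDerivAt.comp x ih

/-- If the iterates `F^[j] q` with `j < s` are distinct modulo one and the interval `(a, q)` avoids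
the orbit of `q` modulo one, then the pull-backs of this interval along the orbit have total
length at most two. -/
lemma IsLiftDeg2.sum_pullback_length_le (hF : IsLiftDeg2 φ F) {s : ℕ} {q x : ℝ} {k : ℤ}
    (hq : F^[s] q = q + k) (hxq : x ≤ q)
    (hdist : ∀ i < s, ∀ j < s, ∀ m : ℤ, F^[i] q = F^[j] q + m → i = j)
    (havoid : ∀ (i : ℕ) (m : ℤ), F^[i] q + m ∉ Ioo (F^[s] x - k) q) :
    ∑ j ∈ Finset.range s, (F^[j] q - F^[j] x) ≤ 2 := by
  have hav : ∀ j < s, ∀ (i : ℕ) (m : ℤ), F^[i] q + m ∉ Ioo (F^[j] x) (F^[j] q) := by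
    intro j hj i m hmem
    have hmono := hF.2.1.iterate (s - j)
    have h1 := hmono hmem.1
    have h2 := hmono hmem.2
    rw [← Function.iterate_add_apply, Nat.sub_add_cancel hj.le, hF.iterate_add_intCast,
      ← Function.iterate_add_apply] at h1 h2
    rw [hq] at h2
    refine havoid (s - j + i) (2 ^ (s - j) * m - k) ⟨?_, ?_⟩ <;> push_cast at * <;> linarith
  have hlen : ∀ j < s, F^[j] q - F^[j] x ≤ 1 := by
    intro j hj
    by_contra! hlt
    refine hav j hj j (-1) ⟨?_, ?_⟩ <;> push_cast <;> linarith
  set I : ℕ → Set ℝ := fun j =>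
    Ioo (Int.fract (F^[j] q) - (F^[j] q - F^[j] x)) (Int.fract (F^[j] q)) with hI
  have hnot : ∀ i < s, ∀ j < s, Int.fract (F^[i] q) ∉ I j := by
    intro i hi j hj hmem
    refine hav j hj i (⌊F^[j] q⌋ - ⌊F^[i] q⌋) ⟨?_, ?_⟩
    · have := hmem.1
      simp only [Int.fract] at this
      push_cast
      linarith
    · have := hmem.2
      simp only [Int.fract] at this
      push_cast
      linarith
  have hdisj : ((Finset.range s : Finset ℕ) : Set ℕ).PairwiseDisjoint I := by
    intro i hi j hj hij
    simp only [Finset.coe_range, mem_Iio] at hi hj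
    refine Set.disjoint_left.2 fun y hyi hyj => ?_
    rcases lt_trichotomy (Int.fract (F^[i] q)) (Int.fract (F^[j] q)) with hlt | heq | hlt
    · exact hnot i hi j hj ⟨hyj.1.trans hyi.2, hlt⟩
    · refine hij (hdist i hi j hj (⌊F^[i] q⌋ - ⌊F^[j] q⌋) ?_)
      simp only [Int.fract] at heq
      push_cast
      linarith
    · exact hnot j hj i hi ⟨hyi.1.trans hyj.2, hlt⟩
  have hnonneg : ∀ j, 0 ≤ F^[j] q - F^[j] x := fun j =>
    sub_nonneg.2 (hF.2.1.monotone.iterate j hxq)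
  have hvol := measure_biUnion_finset (μ := volume) hdisj fun j _ => measurableSet_Ioo
  have hsub : (⋃ j ∈ Finset.range s, I j) ⊆ Ioo (-1 : ℝ) 1 := by
    refine iUnion₂_subset fun j hj y hy => ⟨?_, hy.2.trans (Int.fract_lt_one _)⟩
    have h1 := hlen j (Finset.mem_range.1 hj)
    have h2 := Int.fract_nonneg (F^[j] q)
    linarith [hy.1]
  have hle := measure_mono (μ := volume) hsub
  rw [hvol] at hle
  simp only [hI, Real.volume_Ioo, sub_sub_cancel] at hle
  rw [← ENNReal.ofReal_sum_of_nonneg fun j _ => hnonneg j] at hle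
  have := (ENNReal.ofReal_le_ofReal_iff (by norm_num)).1 hle
  linarith

/-- Bounded distortion along a parabolic periodic orbit: the return map to the period does not
expand distances to `q` by more than a uniform factor on the pull-back of an interval ending at `q`
and avoiding the orbit of `q`. -/
lemma IsLiftDeg2.exists_distortion_bound (hF : IsLiftDeg2 φ F) (hC2 : ContDiff ℝ 2 F)
    (hpos : ∀ x, 0 < deriv F x) :
    ∃ M : ℝ, 0 < M ∧ ∀ (s : ℕ) (q x : ℝ) (k : ℤ), F^[s] q = q + k → x ≤ q →
      (∀ i < s, ∀ j < s, ∀ m : ℤ, F^[i] q = F^[j] q + m → i = j) →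
      (∀ (i : ℕ) (m : ℤ), F^[i] q + m ∉ Ioo (F^[s] x - k) q) →
      birkhoffSum F (fun t => Real.log (deriv F t)) s q = 0 →
      ∀ y ∈ Icc x q, F^[s] q - F^[s] y ≤ M * (q - y) := by
  obtain ⟨C, hC0, hC⟩ := hF.exists_lipschitz_log_deriv hC2 hpos
  refine ⟨Real.exp (C * 2), Real.exp_pos _, fun s q x k hq hxq hdist havoid hpar => ?_⟩
  have hsum := hF.sum_pullback_length_le hq hxq hdist havoid
  have hderiv := hasDerivAt_iterate_exp_birkhoffSum (hC2.differentiable two_ne_zero) hpos s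
  have hbound : ∀ y ∈ Icc x q, deriv (F^[s]) y ≤ Real.exp (C * 2) := by
    intro y hy
    rw [(hderiv y).deriv, Real.exp_le_exp]
    calc birkhoffSum F (fun t => Real.log (deriv F t)) s y
        = birkhoffSum F (fun t => Real.log (deriv F t)) s y
          - birkhoffSum F (fun t => Real.log (deriv F t)) s q := by rw [hpar, sub_zero]
      _ = ∑ j ∈ Finset.range s, (Real.log (deriv F (F^[j] y)) - Real.log (deriv F (F^[j] q))) := by
          simp only [birkhoffSum, Finset.sum_sub_distrib]
      _ ≤ ∑ j ∈ Finset.range s, C * (F^[j] q - F^[j] x) := by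
          refine Finset.sum_le_sum fun j _ => (le_abs_self _).trans ((hC _ _).trans ?_)
          refine mul_le_mul_of_nonneg_left ?_ hC0
          have h1 := hF.2.1.monotone.iterate j hy.1
          have h2 := hF.2.1.monotone.iterate j hy.2
          rw [abs_sub_comm, abs_of_nonneg (by linarith)]
          linarith
      _ ≤ C * 2 := by
          rw [← Finset.mul_sum]
          exact mul_le_mul_of_nonneg_left hsum hC0
  intro y hy
  exact (convex_Icc x q).image_sub_le_mul_sub_of_deriv_le
    (hF.1.iterate s).continuousOn
    (fun z _ => (hderiv z).differentiableAt.differentiableWithinAt)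
    (fun z hz => hbound z (interior_subset hz)) y hy q ⟨hxq, le_rfl⟩ hy.2

lemma iterate_mem_lambdaSet {p : UnitAddCircle} (hp : p ∈ lambdaSet φ) (i : ℕ) :
    φ^[i] p ∈ lambdaSet φ := by
  refine ⟨trivial, fun hmem => ?_⟩
  obtain ⟨n, hn⟩ := mem_iUnion.1 hmem
  rw [mem_preimage, ← Function.iterate_add_apply] at hn
  exact hp.2 (mem_iUnion.2 ⟨n + i, hn⟩)

lemma birkhoffSum_iterate_of_isPeriodicPt {α : Type*} {f : α → α} {n : ℕ} {x : α}
    (hx : Function.IsPeriodicPt f n x) (g : α → ℝ) (i : ℕ) :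
    birkhoffSum f g n (f^[i] x) = birkhoffSum f g n x := by
  induction i with
  | zero => rfl
  | succ i ih =>
    have h1 := birkhoffSum_apply_sub_birkhoffSum f g n (f^[i] x)
    rw [(hx.apply_iterate i).eq, sub_self, sub_eq_zero] at h1
    rw [Function.iterate_succ_apply', h1, ih]

lemma birkhoffSum_mul_of_isPeriodicPt {α : Type*} {f : α → α} {n : ℕ} {x : α}
    (hx : Function.IsPeriodicPt f n x) (g : α → ℝ) (m : ℕ) :
    birkhoffSum f g (n * m) x = m * birkhoffSum f g n x := by
  induction m with
  | zero => simp
  | succ m ih =>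
    rw [Nat.mul_succ, birkhoffSum_add, ih, (hx.mul_const m).eq]
    push_cast
    ring

lemma IsLiftDeg2.birkhoffSum_log_deriv_eq_zero (hF : IsLiftDeg2 φ F) (hC2 : ContDiff ℝ 2 F)
    (hpos : ∀ x, 0 < deriv F x) {p : UnitAddCircle} (hp : IsParabolicPeriodicPt φ F p)
    {i : ℕ} {q : ℝ} (hq : φ^[i] p = (q : UnitAddCircle)) :
    birkhoffSum F (fun t => Real.log (deriv F t)) (Function.minimalPeriod φ p) q = 0 := by
  obtain ⟨n, hn, hper, hder⟩ := hp
  have hcoe : ∀ (m : ℕ) (x : ℝ), birkhoffSum F (fun t => Real.log (deriv F t)) m x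
      = birkhoffSum φ hF.log_deriv_periodic.lift m (x : UnitAddCircle) := by
    intro m x
    refine Finset.sum_congr rfl fun j _ => ?_
    rw [hF.iterate_coe, Function.Periodic.lift_coe]
  rw [hcoe, ← hq, birkhoffSum_iterate_of_isPeriodicPt (Function.isPeriodicPt_minimalPeriod φ p)]
  obtain ⟨x, rfl⟩ := QuotientAddGroup.mk_surjective p
  obtain ⟨m, hm⟩ := Function.IsPeriodicPt.minimalPeriod_dvd hper
  have h1 := hder x rfl
  rw [(hasDerivAt_iterate_exp_birkhoffSum (hC2.differentiable two_ne_zero) hpos n x).deriv,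
    Real.exp_eq_one_iff, hcoe, hm] at h1
  have h2 := (birkhoffSum_mul_of_isPeriodicPt (Function.isPeriodicPt_minimalPeriod φ
    (x : UnitAddCircle)) hF.log_deriv_periodic.lift m).symm.trans h1
  rcases mul_eq_zero.1 h2 with h0 | h0
  · rw [Nat.cast_eq_zero] at h0
    subst h0
    omega
  · exact h0

/-- The first orbit point to the right of an interval contained in a fibre. -/
lemma IsDoublingSemiconj.exists_orbit_lift (hh : IsDoublingSemiconj F h) (hF : IsLiftDeg2 φ F)
    {a ℓ : ℝ} (hℓ : 0 < ℓ) (ha : h a = h (a + ℓ)) {p : UnitAddCircle} (hp : p ∈ lambdaSet φ)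
    (hper : 0 < Function.minimalPeriod φ p) :
    ∃ q ∈ Ioc (a + ℓ) (a + 1), (∃ i, φ^[i] p = (q : UnitAddCircle)) ∧
      (∀ t, h t = h q → t = q) ∧ (∃ k : ℤ, F^[Function.minimalPeriod φ p] q = q + k) ∧
      (∀ i < Function.minimalPeriod φ p, ∀ j < Function.minimalPeriod φ p, ∀ m : ℤ,
        F^[i] q = F^[j] q + m → i = j) ∧
      ∀ (i : ℕ) (m : ℤ), F^[i] q + m ∉ Ioo a q := by
  set s := Function.minimalPeriod φ p with hs
  set O : Set UnitAddCircle := range fun i => φ^[i] p with hO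
  have hOfin : O.Finite := by
    refine ((Set.finite_Iio s).image fun i => φ^[i] p).subset ?_
    rintro _ ⟨i, rfl⟩
    exact ⟨i % s, Nat.mod_lt _ hper, Function.iterate_mod_minimalPeriod_eq⟩
  have hclosed : IsClosed ((fun t : ℝ => (t : UnitAddCircle)) ⁻¹' O) :=
    hOfin.isClosed.preimage (AddCircle.continuous_mk' 1)
  have hne : (Icc a (a + 1) ∩ (fun t : ℝ => (t : UnitAddCircle)) ⁻¹' O).Nonempty := by
    have hp' : p ∈ (univ : Set UnitAddCircle) := trivial
    rw [← AddCircle.coe_image_Ico_eq (1 : ℝ) a] at hp'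
    obtain ⟨t, ht, rfl⟩ := hp'
    exact ⟨t, ⟨ht.1, ht.2.le⟩, 0, rfl⟩
  obtain ⟨q, ⟨hqI, i₀, hi₀⟩, hleast⟩ := (isCompact_Icc.inter_right hclosed).exists_isLeast hne
  simp only at hi₀
  have hpp : p ∈ Function.periodicPts φ := Function.minimalPeriod_pos_iff_mem_periodicPts.1 hper
  have hqper : φ^[s] (q : UnitAddCircle) = q := by
    rw [← hi₀]
    exact (Function.isPeriodicPt_minimalPeriod φ p).apply_iterate i₀
  have htriv : ∀ t, h t = h q → t = q := fun t ht =>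
    hh.eq_of_map_eq_of_mem_lambdaSet hF hper (hi₀ ▸ iterate_mem_lambdaSet hp i₀) hqper ht
  refine ⟨q, ⟨?_, hqI.2⟩, ⟨i₀, hi₀⟩, htriv,
    unitAddCircle_coe_eq_iff.1 ((hF.iterate_coe s q).symm.trans hqper), ?_, ?_⟩
  · by_contra! hle
    have h1 : h q = h a := le_antisymm (ha ▸ hh.monotone hle) (hh.monotone hqI.1)
    have h2 := htriv a h1.symm
    have h3 := htriv (a + ℓ) (ha ▸ h1.symm)
    linarith
  · intro i hi j hj m hij
    have hmin : Function.minimalPeriod φ (q : UnitAddCircle) = s := by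
      rw [← hi₀, Function.minimalPeriod_apply_iterate hpp]
    rw [← hmin] at hi hj
    refine Function.iterate_injOn_Iio_minimalPeriod hi hj ?_
    simp only [hF.iterate_coe]
    exact unitAddCircle_coe_eq_iff.2 ⟨m, hij⟩
  · intro i m hmem
    refine (hleast ⟨⟨hmem.1.le, hmem.2.le.trans hqI.2⟩, i + i₀, ?_⟩).not_gt hmem.2
    simp only [Function.iterate_add_apply]
    rw [hi₀, hF.iterate_coe, unitAddCircle_coe_eq_iff]
    exact ⟨-m, by push_cast; ring⟩

/-- Once there is a nondegenerate fibre, parabolic points of `Λ` have bounded minimal period. -/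
lemma IsDoublingSemiconj.exists_minimalPeriod_le (hh : IsDoublingSemiconj F h)
    (hF : IsLiftDeg2 φ F) (hC2 : ContDiff ℝ 2 F) (hpos : ∀ x, 0 < deriv F x)
    {a ℓ : ℝ} (hℓ : 0 < ℓ) (ha : h a = h (a + ℓ)) :
    ∃ N, ∀ p ∈ lambdaSet φ, IsParabolicPeriodicPt φ F p → Function.minimalPeriod φ p ≤ N := by
  obtain ⟨M, hM, hdist⟩ := hF.exists_distortion_bound hC2 hpos
  by_contra! hunb
  choose p hpΛ hpar hN using hunb
  choose q hq horb htriv hret hinj havoid using fun N =>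
    hh.exists_orbit_lift hF hℓ ha (hpΛ N) ((Nat.zero_le N).trans_lt (hN N))
  choose i hi using horb
  choose k hk using hret
  set s : ℕ → ℕ := fun N => Function.minimalPeriod φ (p N) with hs
  choose x hx using fun N => hF.surjective.iterate (s N) (a + k N)
  have hxa : ∀ N, F^[s N] (x N) - k N = a := fun N => by rw [hx, add_sub_cancel_right]
  have hxq : ∀ N, x N ≤ q N := by
    intro N
    rw [← (hF.2.1.iterate (s N)).le_iff_le, hx, hk]
    linarith [(hq N).1]
  have hbound : ∀ N, ∀ y ∈ Icc (x N) (q N),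
      F^[s N] (q N) - F^[s N] y ≤ M * (q N - y) := fun N =>
    hdist (s N) (q N) (x N) (k N) (hk N) (hxq N) (hinj N) ((hxa N).symm ▸ havoid N)
      (hF.birkhoffSum_log_deriv_eq_zero hC2 hpos (hpar N) (hi N))
  set c : ℝ := ℓ / M with hc
  have hc0 : 0 < c := div_pos hℓ hM
  have hxc : ∀ N, x N ≤ q N - c := by
    intro N
    have h1 := hbound N (x N) ⟨le_rfl, hxq N⟩
    rw [hx, hk] at h1
    have h2 : ℓ ≤ M * (q N - x N) := by linarith [(hq N).1]
    have h3 : c ≤ q N - x N := by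
      rw [hc, div_le_iff₀ hM]
      linarith
    linarith
  have hsmall : ∀ N, h (q N) - h (q N - c) ≤ (1 / 2) ^ N := by
    intro N
    have h1 : 2 ^ s N * (h (q N) - h (x N)) ≤ 1 := by
      rw [mul_sub, ← hh.map_iterate, ← hh.map_iterate, hk, hx, hh.map_add_intCast,
        hh.map_add_intCast]
      have := hh.monotone (hq N).2
      rw [hh.map_add_one] at this
      linarith
    have h2 : h (q N) - h (x N) ≤ (1 / 2) ^ s N := by
      rw [one_div, inv_pow, ← one_div, le_div_iff₀ (by positivity)]
      linarith
    have h3 : (1 / 2 : ℝ) ^ s N ≤ (1 / 2) ^ N :=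
      pow_le_pow_of_le_one (by norm_num) (by norm_num) (hN N).le
    linarith [hh.monotone (hxc N)]
  obtain ⟨y, -, ψ, hψ, hlim⟩ := (isCompact_Icc (a := a) (b := a + 1)).tendsto_subseq
    (x := q) fun N => ⟨by linarith [(hq N).1], (hq N).2⟩
  have hfib : h (y - c) = h y := by
    refine le_antisymm (hh.monotone (by linarith)) ?_
    have h1 : Tendsto (fun n => h (q (ψ n)) - h (q (ψ n) - c)) atTop (𝓝 (h y - h (y - c))) :=
      ((hh.continuous.tendsto y).comp hlim).sub
        ((hh.continuous.tendsto (y - c)).comp (hlim.sub_const c))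
    have h2 : Tendsto (fun n => (1 / 2 : ℝ) ^ ψ n) atTop (𝓝 0) :=
      (tendsto_pow_atTop_nhds_zero_of_lt_one (by norm_num) (by norm_num)).comp hψ.tendsto_atTop
    linarith [le_of_tendsto_of_tendsto' h1 h2 fun n => hsmall (ψ n)]
  obtain ⟨n, hn⟩ := (Metric.tendsto_nhds.1 hlim (min c (c / M))
    (lt_min hc0 (div_pos hc0 hM))).exists
  rw [Real.dist_eq, Function.comp_apply, lt_min_iff, abs_lt] at hn
  obtain ⟨⟨hn1, hn2⟩, hn3⟩ := hn
  set N := ψ n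
  have hyq : y < q N := by
    by_contra! hle
    have h1 : h (q N) = h y := le_antisymm (hh.monotone hle)
      (hfib ▸ hh.monotone (by linarith))
    have h2 := htriv N y h1.symm
    have h3 := htriv N (y - c) (hfib.trans h1.symm)
    linarith
  have h1 := hbound N y ⟨by linarith [hxc N], hyq.le⟩
  have h2 : M * (q N - y) < c := by
    have := (lt_div_iff₀ hM).1 ((le_abs_self _).trans_lt hn3)
    linarith
  have h3 : y - c + k N ≤ F^[s N] y := by
    rw [hk] at h1
    linarith
  have h4 := hh.monotone h3
  rw [hh.map_add_intCast, hfib, hh.map_iterate] at h4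
  have h5 : 2 ^ s N * h (q N) = h (q N) + k N := by
    rw [← hh.map_iterate, hk, hh.map_add_intCast]
  have h6 : (2 : ℝ) ≤ 2 ^ s N := by
    simpa using pow_le_pow_right₀ (one_le_two (α := ℝ)) ((Nat.zero_le N).trans_lt (hN N))
  have h7 : h y ≤ h (q N) := hh.monotone hyq.le
  have h8 : h y = h (q N) := by nlinarith
  exact hyq.ne (htriv N y h8)

end Lift

/-- the set of parabolic periodic points of `φ` contained in `Λ`
is finite. -/
theorem parabolic_points_in_lambda_finite
    (φ : UnitAddCircle → UnitAddCircle) (F : ℝ → ℝ)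
    (hF : IsLiftDeg2 φ F) (hC2 : ContDiff ℝ 2 F) (hpos : ∀ x : ℝ, 0 < deriv F x)
    (hnc : ¬ ConjugateToDoubling φ)
    (hfin : {I | IsMaxPeriodicInterval φ I}.Finite)
    (hne : {I | IsMaxPeriodicInterval φ I}.Nonempty) :
    {x | x ∈ lambdaSet φ ∧ IsParabolicPeriodicPt φ F x}.Finite := by
  obtain ⟨h, hh⟩ := hF.exists_isDoublingSemiconj
  obtain ⟨_, ⟨s, hs, ⟨a, ℓ, hℓ, hℓ1, rfl⟩, hbij⟩, -⟩ := hne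
  obtain ⟨N, hN⟩ := hh.exists_minimalPeriod_le hF hC2 hpos hℓ
    (hh.map_eq_of_isPeriodicInterval hF hℓ hℓ1 hs hbij)
  refine ((Set.finite_Icc 1 N).biUnion fun n hn =>
    hh.finite_lambdaSet_isPeriodicPt hF hn.1).subset ?_
  rintro x ⟨hx, hpar⟩
  obtain ⟨n, hn, hper, -⟩ := id hpar
  exact mem_biUnion ⟨Function.IsPeriodicPt.minimalPeriod_pos hn hper, hN x hx hpar⟩
    ⟨hx, Function.isPeriodicPt_minimalPeriod φ x⟩
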